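/- Let A be a rigid, monoidal-preadditive abelian category in which every monomorphism splits and whose unit object 𝟙 is simple. If a and b are objects of A such that a ⊗ b is a zero object, then a is a zero object or b is a zero object. -/

import Mathlib

open CategoryTheory CategoryTheory.Limits CategoryTheory.MonoidalCategory

universe v u

/-- If the coevaluation of an exact pairing vanishes, then the second object is zero. -/
theorem CategoryTheory.ExactPairing.isZero_of_coevaluation_eq_zero
    {C : Type u} [Category.{v} C] [Preadditive C] [MonoidalCategory C] [MonoidalPreadditive C]
    (X Y : C) [ExactPairing X Y] (h : η_ X Y = 0) : IsZero Y := by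
  have e := ExactPairing.coevaluation_evaluation X Y
  rw [h, MonoidalPreadditive.whiskerLeft_zero, zero_comp] at e
  rw [IsZero.iff_id_eq_zero]
  calc 𝟙 Y = (ρ_ Y).inv ≫ ((ρ_ Y).hom ≫ (λ_ Y).inv) ≫ (λ_ Y).hom := by simp
    _ = 0 := by rw [← e, zero_comp, comp_zero]

/-- If the tensor unit is a retract of `X ⊗ Y` and `Y ⊗ Z` is zero, then `Z` is zero. -/
theorem CategoryTheory.isZero_of_retract_unit_tensor
    {C : Type u} [Category.{v} C] [Preadditive C] [MonoidalCategory C] [MonoidalPreadditive C]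
    {X Y Z : C} (r : Retract (𝟙_ C) (X ⊗ Y)) (h : IsZero (Y ⊗ Z)) : IsZero Z := by
  have h' : IsZero ((X ⊗ Y) ⊗ Z) :=
    ((tensorLeft X).map_isZero h).of_iso (α_ X Y Z)
  rw [IsZero.iff_id_eq_zero]
  calc 𝟙 Z = (λ_ Z).inv ≫ (r.i ▷ Z ≫ r.r ▷ Z) ≫ (λ_ Z).hom := by
        rw [← comp_whiskerRight, r.retract]; simp
    _ = 0 := by rw [h'.eq_of_tgt (r.i ▷ Z) 0, zero_comp, zero_comp, comp_zero]

/-- In a rigid, monoidal-preadditive abelian category in which every monomorphism splits and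
whose unit object is simple, if `a ⊗ b` is a zero object then `a` is a zero object or `b` is a
zero object. -/
theorem isZero_or_isZero_of_isZero_tensor
    (A : Type u) [Category.{v} A] [Abelian A] [MonoidalCategory A]
    [MonoidalPreadditive A] [RigidCategory A]
    (hsplit : ∀ {X Y : A} (f : X ⟶ Y), Mono f → IsSplitMono f)
    [Simple (𝟙_ A)]
    (a b : A) (h : IsZero (a ⊗ b)) :
    IsZero a ∨ IsZero b := by
  refine or_iff_not_imp_left.2 fun ha => ?_
  have hη : η_ (ᘁa) a ≠ 0 := fun h0 => ha (ExactPairing.isZero_of_coevaluation_eq_zero _ _ h0)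
  have : Mono (η_ (ᘁa) a) :=
    Preadditive.mono_of_kernel_zero (kernel_zero_of_nonzero_from_simple hη)
  obtain ⟨⟨s⟩⟩ := hsplit _ this
  exact isZero_of_retract_unit_tensor ⟨_, s.retraction, s.id⟩ h
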